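/- Let q₀ ≥ 1 and p₀ ∈ {q₀, q₀+1}. Then Δ_O = {eᵢ − fᵢ : 1 ≤ i ≤ q₀} ∪ {fᵢ − e_{i+1} : 1 ≤ i ≤ p₀−1} ∪ {e_{p₀} + f_{q₀}} is a base (set of simple roots) of the root system Φ(D): each element of Δ_O is a root, the elements of Δ_O are linearly independent over ℚ, and every root β ∈ Φ(D) is an integer linear combination of elements of Δ_O with coefficients either all nonnegative or all nonpositive. Moreover, no element of Δ_O is of the form ±(eᵢ − eⱼ) or ±(fᵢ − fⱼ) with i ≠ j; i.e., every element of Δ_O is a non-compact root of so(2p₀, 2q₀) relative to its compact Cartan subalgebra. -/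

import Mathlib

/-- The basis vector `e_{i+1}` of `ℚ^{p₀+q₀}` (`0`-based index `i < p₀`). -/
def EV (p₀ q₀ i : ℕ) : Fin (p₀ + q₀) → ℚ := fun k => if (k : ℕ) = i then 1 else 0

/-- The basis vector `f_{j+1}` of `ℚ^{p₀+q₀}` (`0`-based index `j < q₀`). -/
def FV (p₀ q₀ j : ℕ) : Fin (p₀ + q₀) → ℚ := fun k => if (k : ℕ) = p₀ + j then 1 else 0

/-- The root system of type `D_{p₀+q₀}`:
`Φ(D) = {±eᵢ ± eⱼ : i < j ≤ p₀} ∪ {±fᵢ ± fⱼ : i < j ≤ q₀} ∪ {±eᵢ ± fⱼ}` (written `0`-based). -/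
def PhiD (p₀ q₀ : ℕ) : Set (Fin (p₀ + q₀) → ℚ) :=
  {v | (∃ i j : ℕ, i < j ∧ j < p₀ ∧ ∃ ε δ : ℚ, (ε = 1 ∨ ε = -1) ∧ (δ = 1 ∨ δ = -1) ∧
          v = ε • EV p₀ q₀ i + δ • EV p₀ q₀ j) ∨
       (∃ i j : ℕ, i < j ∧ j < q₀ ∧ ∃ ε δ : ℚ, (ε = 1 ∨ ε = -1) ∧ (δ = 1 ∨ δ = -1) ∧
          v = ε • FV p₀ q₀ i + δ • FV p₀ q₀ j) ∨
       (∃ i j : ℕ, i < p₀ ∧ j < q₀ ∧ ∃ ε δ : ℚ, (ε = 1 ∨ ε = -1) ∧ (δ = 1 ∨ δ = -1) ∧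
          v = ε • EV p₀ q₀ i + δ • FV p₀ q₀ j)}

/-- An enumeration (`0`-based index `k < p₀+q₀`) of the simple roots
`Δ_O = {eᵢ − fᵢ : 1 ≤ i ≤ q₀} ∪ {fᵢ − e_{i+1} : 1 ≤ i ≤ p₀−1} ∪ {e_{p₀} + f_{q₀}}`
(for `p₀ ∈ {q₀, q₀+1}`), interleaved as `e₁−f₁, f₁−e₂, e₂−f₂, …`, ending with `e_{p₀}+f_{q₀}`. -/
def deltaO (p₀ q₀ k : ℕ) : Fin (p₀ + q₀) → ℚ :=
  if k + 1 = p₀ + q₀ then EV p₀ q₀ (p₀ - 1) + FV p₀ q₀ (q₀ - 1)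
  else if k % 2 = 0 then EV p₀ q₀ (k / 2) - FV p₀ q₀ (k / 2)
  else FV p₀ q₀ (k / 2) - EV p₀ q₀ (k / 2 + 1)


/-- the interleaved basis -/
def gV (p q m : ℕ) : Fin (p + q) → ℚ := if m % 2 = 0 then EV p q (m / 2) else FV p q (m / 2)

def NN (p q : ℕ) (v : Fin (p + q) → ℚ) : Prop :=
  ∃ c : Fin (p + q) → ℤ, v = ∑ k : Fin (p + q), (c k : ℚ) • deltaO p q (k : ℕ) ∧ ∀ k, 0 ≤ c k

lemma NN.add {p q : ℕ} {v w : Fin (p + q) → ℚ} (hv : NN p q v) (hw : NN p q w) :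
    NN p q (v + w) := by
  obtain ⟨c, rfl, hc⟩ := hv
  obtain ⟨d, rfl, hd⟩ := hw
  refine ⟨c + d, ?_, fun k => add_nonneg (hc k) (hd k)⟩
  rw [← Finset.sum_add_distrib]
  refine Finset.sum_congr rfl fun k _ => ?_
  rw [Pi.add_apply, Int.cast_add, add_smul]

lemma NN.zero (p q : ℕ) : NN p q 0 := ⟨0, by simp, by simp⟩

lemma NN.simple {p q k : ℕ} (hk : k < p + q) : NN p q (deltaO p q k) := by
  refine ⟨Pi.single ⟨k, hk⟩ 1, ?_, ?_⟩
  · rw [Finset.sum_eq_single ⟨k, hk⟩]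
    · simp
    · intro b _ hb
      simp [Pi.single_eq_of_ne hb]
    · simp
  · intro j
    by_cases h : j = ⟨k, hk⟩
    · subst h; simp
    · simp [Pi.single_eq_of_ne h]

lemma delta_step {p q k : ℕ} (hk : k + 1 < p + q) :
    deltaO p q k = gV p q k - gV p q (k + 1) := by
  unfold deltaO gV
  rw [if_neg (by omega)]
  by_cases h : k % 2 = 0
  · rw [if_pos h, if_pos h, if_neg (by omega), show (k + 1) / 2 = k / 2 by omega]
  · rw [if_neg h, if_neg h, if_pos (by omega), show (k + 1) / 2 = k / 2 + 1 by omega]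

lemma delta_last {p q : ℕ} (hq : 1 ≤ q) (hp : p = q ∨ p = q + 1) :
    deltaO p q (p + q - 1) = gV p q (p + q - 2) + gV p q (p + q - 1) := by
  unfold deltaO gV
  rw [if_pos (by omega)]
  rcases hp with rfl | rfl
  · rw [if_pos (by omega), if_neg (by omega), show (p + p - 2) / 2 = p - 1 by omega,
      show (p + p - 1) / 2 = p - 1 by omega]
  · rw [if_neg (by omega), if_pos (by omega), show (q + 1 + q - 2) / 2 = q - 1 by omega,
      show (q + 1 + q - 1) / 2 = q + 1 - 1 by omega]
    exact add_comm _ _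

lemma NN.sub {p q a b : ℕ} (hab : a ≤ b) (hb : b < p + q) : NN p q (gV p q a - gV p q b) := by
  induction b, hab using Nat.le_induction with
  | base => simpa using NN.zero p q
  | succ b hab ih =>
    have h := (ih (by omega)).add (NN.simple (p := p) (q := q) (k := b) (by omega))
    rw [delta_step hb] at h
    simpa using h

lemma NN.plus {p q a b : ℕ} (hq : 1 ≤ q) (hp : p = q ∨ p = q + 1) (hab : a < b)
    (hb : b < p + q) : NN p q (gV p q a + gV p q b) := by
  have h1 : NN p q (gV p q a - gV p q (p + q - 2)) := NN.sub (by omega) (by omega)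
  have h2 : NN p q (gV p q b - gV p q (p + q - 1)) := NN.sub (by omega) (by omega)
  have h3 := NN.simple (p := p) (q := q) (k := p + q - 1) (by omega)
  rw [delta_last hq hp] at h3
  have := (h1.add h2).add h3
  convert this using 1
  abel

def PM (p q : ℕ) (v : Fin (p + q) → ℚ) : Prop :=
  ∃ c : Fin (p + q) → ℤ, v = ∑ k : Fin (p + q), (c k : ℚ) • deltaO p q (k : ℕ) ∧
    ((∀ k, 0 ≤ c k) ∨ (∀ k, c k ≤ 0))

lemma NN.pm {p q : ℕ} {v : Fin (p + q) → ℚ} (h : NN p q v) : PM p q v := by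
  obtain ⟨c, h1, h2⟩ := h
  exact ⟨c, h1, Or.inl h2⟩

lemma NN.pm_neg {p q : ℕ} {v : Fin (p + q) → ℚ} (h : NN p q v) : PM p q (-v) := by
  obtain ⟨c, h1, h2⟩ := h
  refine ⟨-c, ?_, Or.inr fun k => by simpa using h2 k⟩
  rw [h1, ← Finset.sum_neg_distrib]
  refine Finset.sum_congr rfl fun k _ => ?_
  simp

lemma pm_lt {p q a b : ℕ} (hq : 1 ≤ q) (hp : p = q ∨ p = q + 1) (hab : a < b)
    (hb : b < p + q) {x y : ℚ} (hx : x = 1 ∨ x = -1) (hy : y = 1 ∨ y = -1) :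
    PM p q (x • gV p q a + y • gV p q b) := by
  have h1 := NN.plus hq hp hab hb
  have h2 := NN.sub hab.le hb
  rcases hx with rfl | rfl <;> rcases hy with rfl | rfl
  · convert h1.pm using 1; simp
  · convert h2.pm using 1; simp [sub_eq_add_neg]
  · convert h2.pm_neg using 1; simp; abel
  · convert h1.pm_neg using 1; simp; abel

lemma pm_ne {p q a b : ℕ} (hq : 1 ≤ q) (hp : p = q ∨ p = q + 1) (hab : a ≠ b)
    (ha : a < p + q) (hb : b < p + q) {x y : ℚ} (hx : x = 1 ∨ x = -1) (hy : y = 1 ∨ y = -1) :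
    PM p q (x • gV p q a + y • gV p q b) := by
  rcases lt_or_gt_of_ne hab with h | h
  · exact pm_lt hq hp h hb hx hy
  · rw [add_comm]; exact pm_lt hq hp h ha hy hx

lemma EV_eq (p q i : ℕ) : EV p q i = gV p q (2 * i) := by
  unfold gV
  rw [if_pos (by omega), show 2 * i / 2 = i by omega]

lemma FV_eq (p q i : ℕ) : FV p q i = gV p q (2 * i + 1) := by
  unfold gV
  rw [if_neg (by omega), show (2 * i + 1) / 2 = i by omega]

lemma delta_form {p q k : ℕ} (hq : 1 ≤ q) (hp : p = q ∨ p = q + 1) (hk : k < p + q) :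
    ∃ i j : ℕ, i < p ∧ j < q ∧ ∃ ε δ : ℚ, (ε = 1 ∨ ε = -1) ∧ (δ = 1 ∨ δ = -1) ∧
      deltaO p q k = ε • EV p q i + δ • FV p q j := by
  unfold deltaO
  split_ifs with h1 h2
  · exact ⟨p - 1, q - 1, by omega, by omega, 1, 1, by simp, by simp, by simp⟩
  · exact ⟨k / 2, k / 2, by omega, by omega, 1, -1, by simp, by simp, by simp [sub_eq_add_neg]⟩
  · exact ⟨k / 2 + 1, k / 2, by omega, by omega, -1, 1, by simp, by simp, by simp; abel⟩

lemma PM.mem_span {p q : ℕ} {v : Fin (p + q) → ℚ} (h : PM p q v) :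
    v ∈ Submodule.span ℚ (Set.range (fun k : Fin (p + q) => deltaO p q (k : ℕ))) := by
  obtain ⟨c, rfl, -⟩ := h
  exact Submodule.sum_mem _ fun k _ => Submodule.smul_mem _ _ (Submodule.subset_span ⟨k, rfl⟩)

lemma g_mem_span {p q a : ℕ} (hq : 1 ≤ q) (hp : p = q ∨ p = q + 1) (ha : a < p + q) :
    gV p q a ∈ Submodule.span ℚ (Set.range (fun k : Fin (p + q) => deltaO p q (k : ℕ))) := by
  obtain ⟨b, hb, hab⟩ : ∃ b, b < p + q ∧ a ≠ b := by
    by_cases h : a = 0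
    · exact ⟨1, by omega, by omega⟩
    · exact ⟨0, by omega, h⟩
  have h1 := (pm_ne hq hp hab ha hb (x := 1) (y := 1) (by simp) (by simp)).mem_span
  have h2 := (pm_ne hq hp hab ha hb (x := 1) (y := -1) (by simp) (by simp)).mem_span
  have h3 := Submodule.smul_mem _ (1 / 2 : ℚ) (Submodule.add_mem _ h1 h2)
  convert h3 using 1
  module

lemma delta_indep {p q : ℕ} (hq : 1 ≤ q) (hp : p = q ∨ p = q + 1) :
    LinearIndependent ℚ (fun k : Fin (p + q) => deltaO p q (k : ℕ)) := by
  apply linearIndependent_of_top_le_span_of_card_eq_finrank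
  · intro v _
    rw [pi_eq_sum_univ v]
    refine Submodule.sum_mem _ fun k _ => Submodule.smul_mem _ _ ?_
    by_cases hk : (k : ℕ) < p
    · have h := g_mem_span hq hp (a := 2 * k) (by omega)
      rw [← EV_eq] at h
      convert h using 1
      ext j
      simp [EV, Fin.ext_iff, eq_comm]
    · have h := g_mem_span hq hp (a := 2 * (k - p) + 1) (by omega)
      rw [← FV_eq] at h
      convert h using 1
      ext j
      have : p + ((k : ℕ) - p) = k := by omega
      simp [FV, Fin.ext_iff, eq_comm, this]
  · simp

lemma ne_of_E {p q k i j : ℕ} (hq : 1 ≤ q) (hp : p = q ∨ p = q + 1) (hk : k < p + q)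
    (hi : i < p) (hj : j < p) (x y : ℚ) : deltaO p q k ≠ x • EV p q i + y • EV p q j := by
  obtain ⟨a, b, ha, hb, ε, δ, -, hδ, h⟩ := delta_form hq hp hk
  rw [h]
  intro h
  have := congrFun h ⟨p + b, by omega⟩
  simp [EV, FV, show p + b ≠ i by omega, show p + b ≠ j by omega, show p + b ≠ a by omega] at this
  rcases hδ with rfl | rfl <;> norm_num at this

lemma ne_of_F {p q k : ℕ} (i j : ℕ) (hq : 1 ≤ q) (hp : p = q ∨ p = q + 1) (hk : k < p + q)
    (x y : ℚ) : deltaO p q k ≠ x • FV p q i + y • FV p q j := by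
  obtain ⟨a, b, ha, hb, ε, δ, hε, -, h⟩ := delta_form hq hp hk
  rw [h]
  intro h
  have := congrFun h ⟨a, by omega⟩
  simp [EV, FV, show a ≠ p + i by omega, show a ≠ p + j by omega, show a ≠ p + b by omega] at this
  rcases hε with rfl | rfl <;> norm_num at this

/-- For `q₀ ≥ 1` and `p₀ ∈ {q₀, q₀+1}`, `Δ_O` is a base of `Φ(D)`: its elements are roots,
it enumerates exactly the claimed set, it is linearly independent over `ℚ`, every root is an
integer combination of its elements with coefficients all nonnegative or all nonpositive, and
no element of `Δ_O` is of the form `±(eᵢ−eⱼ)` or `±(fᵢ−fⱼ)` with `i ≠ j` (non-compactness). -/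
theorem deltaO_isBase_of_PhiD (p₀ q₀ : ℕ) (hq : 1 ≤ q₀) (hp : p₀ = q₀ ∨ p₀ = q₀ + 1) :
    (∀ k : Fin (p₀ + q₀), deltaO p₀ q₀ (k : ℕ) ∈ PhiD p₀ q₀) ∧
    (Set.range (fun k : Fin (p₀ + q₀) => deltaO p₀ q₀ (k : ℕ)) =
      {v | (∃ i : ℕ, i < q₀ ∧ v = EV p₀ q₀ i - FV p₀ q₀ i) ∨
           (∃ i : ℕ, i + 1 < p₀ ∧ v = FV p₀ q₀ i - EV p₀ q₀ (i + 1)) ∨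
           v = EV p₀ q₀ (p₀ - 1) + FV p₀ q₀ (q₀ - 1)}) ∧
    LinearIndependent ℚ (fun k : Fin (p₀ + q₀) => deltaO p₀ q₀ (k : ℕ)) ∧
    (∀ v ∈ PhiD p₀ q₀, ∃ c : Fin (p₀ + q₀) → ℤ,
      v = ∑ k : Fin (p₀ + q₀), (c k : ℚ) • deltaO p₀ q₀ (k : ℕ) ∧
      ((∀ k, 0 ≤ c k) ∨ (∀ k, c k ≤ 0))) ∧
    (∀ k : Fin (p₀ + q₀), ∀ i j : ℕ, i < p₀ → j < p₀ → i ≠ j →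
      deltaO p₀ q₀ (k : ℕ) ≠ EV p₀ q₀ i - EV p₀ q₀ j ∧
      deltaO p₀ q₀ (k : ℕ) ≠ -(EV p₀ q₀ i - EV p₀ q₀ j)) ∧
    (∀ k : Fin (p₀ + q₀), ∀ i j : ℕ, i < q₀ → j < q₀ → i ≠ j →
      deltaO p₀ q₀ (k : ℕ) ≠ FV p₀ q₀ i - FV p₀ q₀ j ∧
      deltaO p₀ q₀ (k : ℕ) ≠ -(FV p₀ q₀ i - FV p₀ q₀ j)) := by
  refine ⟨fun k => Or.inr (Or.inr (delta_form hq hp k.2)), ?_, delta_indep hq hp, ?_, ?_, ?_⟩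
  · ext v
    simp only [Set.mem_range, Set.mem_setOf_eq]
    constructor
    · rintro ⟨k, rfl⟩
      have := k.2
      unfold deltaO
      split_ifs with h1 h2
      · exact Or.inr (Or.inr rfl)
      · exact Or.inl ⟨_, by omega, rfl⟩
      · exact Or.inr (Or.inl ⟨_, by omega, rfl⟩)
    · rintro (⟨i, hi, rfl⟩ | ⟨i, hi, rfl⟩ | rfl)
      · refine ⟨⟨2 * i, by omega⟩, ?_⟩
        simp only [deltaO]
        rw [if_neg (by omega), if_pos (by omega), show 2 * i / 2 = i by omega]
      · refine ⟨⟨2 * i + 1, by omega⟩, ?_⟩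
        simp only [deltaO]
        rw [if_neg (by omega), if_neg (by omega), show (2 * i + 1) / 2 = i by omega]
      · refine ⟨⟨p₀ + q₀ - 1, by omega⟩, ?_⟩
        simp only [deltaO]
        rw [if_pos (by omega)]
  · rintro v (⟨i, j, hi, hj, ε, δ, hε, hδ, rfl⟩ | ⟨i, j, hi, hj, ε, δ, hε, hδ, rfl⟩ |
      ⟨i, j, hi, hj, ε, δ, hε, hδ, rfl⟩)
    · rw [EV_eq, EV_eq]
      exact pm_ne hq hp (by omega) (by omega) (by omega) hε hδ
    · rw [FV_eq, FV_eq]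
      exact pm_ne hq hp (by omega) (by omega) (by omega) hε hδ
    · rw [EV_eq, FV_eq]
      exact pm_ne hq hp (by omega) (by omega) (by omega) hε hδ
  · intro k i j hi hj _
    constructor
    · convert ne_of_E hq hp k.2 hi hj 1 (-1) using 1
      module
    · convert ne_of_E hq hp k.2 hi hj (-1) 1 using 1
      module
  · intro k i j hi hj _
    constructor
    · convert ne_of_F i j hq hp k.2 1 (-1) using 1
      module
    · convert ne_of_F i j hq hp k.2 (-1) 1 using 1
      module
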